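/- arXiv:2407.04124 — 2 statements merged into one kernel-verified Lean document; each statement's English description precedes it below -/
import Mathlib

section
/- Let $\mu$ be a regular positive Borel measure on $(0,\infty)$ with $\int_0^\infty 2^{-t}\,d\mu(t) < \infty$. If $(\ln n)\,\widehat{\mu}(\ln n) \to 0$ as $n \to \infty$, then the Helson matrix $H_\mu$ defines a compact operator on $\ell^2(\mathbb N_2)$. -/
open MeasureTheory

abbrev N2 := {n : ℕ // 2 ≤ n}
noncomputable abbrev H2 := lp (fun _ : N2 => ℂ) 2

/-- The Laplace transform of a positive Borel measure on `(0,∞)`. -/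
noncomputable def lap (μ : Measure ℝ) (s : ℝ) : ℝ :=
  (∫⁻ t in Set.Ioi (0:ℝ), ENNReal.ofReal (Real.exp (-s * t)) ∂μ).toReal

/-- The `(m,n)` entry of the Helson matrix `H_μ`, namely `μ̂(ln(mn))/√(mn)`. -/
noncomputable def helsonEntry (μ : Measure ℝ) (m n : N2) : ℂ :=
  (lap μ (Real.log ((m : ℝ) * (n : ℝ))) / Real.sqrt ((m : ℝ) * (n : ℝ)) : ℝ)

noncomputable def e2 (m : N2) : H2 := lp.single 2 m 1

/-- Schur test, finite version. -/
lemma schur_fin (a : N2 → N2 → ℂ) (p : N2 → ℝ) (hp : ∀ n, 0 < p n) (C : ℝ) (hC : 0 ≤ C)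
    (h1 : ∀ m (s : Finset N2), ∑ n ∈ s, ‖a m n‖ * p n ≤ C * p m)
    (h2 : ∀ n (s : Finset N2), ∑ m ∈ s, ‖a m n‖ * p m ≤ C * p n)
    (x : N2 → ℂ) (s t : Finset N2) :
    ∑ n ∈ t, (∑ m ∈ s, ‖a m n‖ * ‖x m‖) ^ 2 ≤ C ^ 2 * ∑ m ∈ s, ‖x m‖ ^ 2 := by
  have hA : ∀ n, (∑ m ∈ s, ‖a m n‖ * ‖x m‖) ^ 2 ≤
      (C * p n) * ∑ m ∈ s, ‖a m n‖ * (‖x m‖ ^ 2 / p m) := by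
    intro n
    refine (Finset.sum_sq_le_sum_mul_sum_of_sq_eq_mul s (f := fun m => ‖a m n‖ * p m)
      (g := fun m => ‖a m n‖ * (‖x m‖ ^ 2 / p m)) ?_ ?_ ?_).trans ?_
    · intro i _; have := hp i; positivity
    · intro i _; have := hp i; positivity
    · intro i _; have := hp i; field_simp
    · refine mul_le_mul_of_nonneg_right (h2 n s) (Finset.sum_nonneg fun i _ => ?_)
      have := hp i; positivity
  calc ∑ n ∈ t, (∑ m ∈ s, ‖a m n‖ * ‖x m‖) ^ 2
      ≤ ∑ n ∈ t, (C * p n) * ∑ m ∈ s, ‖a m n‖ * (‖x m‖ ^ 2 / p m) :=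
        Finset.sum_le_sum fun n _ => hA n
    _ = ∑ m ∈ s, C * (‖x m‖ ^ 2 / p m) * ∑ n ∈ t, ‖a m n‖ * p n := by
        simp_rw [Finset.mul_sum]
        rw [Finset.sum_comm]
        refine Finset.sum_congr rfl fun m _ => Finset.sum_congr rfl fun n _ => ?_
        ring
    _ ≤ ∑ m ∈ s, C * (‖x m‖ ^ 2 / p m) * (C * p m) := by
        refine Finset.sum_le_sum fun m _ => mul_le_mul_of_nonneg_left (h1 m t) ?_
        have := hp m; positivity
    _ = C ^ 2 * ∑ m ∈ s, ‖x m‖ ^ 2 := by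
        rw [Finset.mul_sum]
        refine Finset.sum_congr rfl fun m _ => ?_
        have := (hp m).ne'
        field_simp

lemma H2_sum_le (x : H2) (s : Finset N2) : ∑ m ∈ s, ‖x m‖ ^ 2 ≤ ‖x‖ ^ 2 := by
  have := lp.sum_rpow_le_norm_rpow (p := 2) (by norm_num) x s
  simpa using this

/-- Schur test. -/
lemma schur (a : N2 → N2 → ℂ) (p : N2 → ℝ) (hp : ∀ n, 0 < p n) (C : ℝ) (hC : 0 ≤ C)
    (h1 : ∀ m (s : Finset N2), ∑ n ∈ s, ‖a m n‖ * p n ≤ C * p m)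
    (h2 : ∀ n (s : Finset N2), ∑ m ∈ s, ‖a m n‖ * p m ≤ C * p n) :
    ∃ T : H2 →L[ℂ] H2, ‖T‖ ≤ C ∧ ∀ x n, T x n = ∑' m, a m n * x m := by
  have hsum : ∀ (x : H2) n, Summable fun m => a m n * x m := by
    intro x n
    refine Summable.of_norm (summable_of_sum_le (c := C * ‖x‖) (fun _ => norm_nonneg _) ?_)
    intro s
    have := schur_fin a p hp C hC h1 h2 x s {n}
    simp only [Finset.sum_singleton] at this
    simp only [norm_mul]
    refine abs_le_of_sq_le_sq' ?_ (by positivity) |>.2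
    refine this.trans ?_
    rw [mul_pow]
    exact mul_le_mul_of_nonneg_left (H2_sum_le x s) (by positivity)
  have hbd : ∀ (x : H2) (t : Finset N2),
      ∑ n ∈ t, ‖∑' m, a m n * x m‖ ^ 2 ≤ (C * ‖x‖) ^ 2 := by
    intro x t
    have hlim : Filter.Tendsto (fun s : Finset N2 => ∑ n ∈ t, ‖∑ m ∈ s, a m n * x m‖ ^ 2)
        Filter.atTop (nhds (∑ n ∈ t, ‖∑' m, a m n * x m‖ ^ 2)) :=
      tendsto_finsetSum _ fun n _ => ((hsum x n).hasSum.norm).pow 2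
    refine le_of_tendsto' hlim fun s => ?_
    calc ∑ n ∈ t, ‖∑ m ∈ s, a m n * x m‖ ^ 2
        ≤ ∑ n ∈ t, (∑ m ∈ s, ‖a m n‖ * ‖x m‖) ^ 2 := by
          refine Finset.sum_le_sum fun n _ => pow_le_pow_left₀ (norm_nonneg _) ?_ 2
          refine (norm_sum_le _ _).trans (le_of_eq ?_)
          simp
      _ ≤ C ^ 2 * ∑ m ∈ s, ‖x m‖ ^ 2 := schur_fin a p hp C hC h1 h2 x s t
      _ ≤ (C * ‖x‖) ^ 2 := by
          rw [mul_pow]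
          exact mul_le_mul_of_nonneg_left (H2_sum_le x s) (by positivity)
  have hmem : ∀ x : H2, Memℓp (fun n : N2 => ∑' m, a m n * x m) 2 := by
    intro x
    refine memℓp_gen' (C := (C * ‖x‖) ^ 2) fun s => ?_
    simpa using hbd x s
  let L : H2 →ₗ[ℂ] H2 :=
    { toFun := fun x => ⟨fun n : N2 => ∑' m, a m n * x m, hmem x⟩
      map_add' := by
        intro x y
        apply lp.ext
        funext n
        change ∑' m, a m n * (x m + y m) = (∑' m, a m n * x m) + ∑' m, a m n * y m
        rw [← (hsum x n).tsum_add (hsum y n)]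
        simp only [mul_add]
      map_smul' := by
        intro c x
        apply lp.ext
        funext n
        change ∑' m, a m n * (c * x m) = c * (∑' m, a m n * x m)
        rw [← tsum_mul_left]
        refine tsum_congr fun m => ?_
        ring }
  have hL : ∀ x, ‖L x‖ ≤ C * ‖x‖ := by
    intro x
    refine lp.norm_le_of_forall_sum_le (by norm_num) (by positivity) fun s => ?_
    have := hbd x s
    simp only [ENNReal.toReal_ofNat, Real.rpow_ofNat]
    exact this
  exact ⟨L.mkContinuous C hL, L.mkContinuous_norm_le hC hL, fun x n => rfl⟩

lemma term_le (b : ℝ) (hb : 0 < b) (n : ℕ) (hn : 2 ≤ n) :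
    1 / (n * √(Real.log n) * (b + Real.log n)) ≤
      2 / √b * Real.arctan (√(Real.log n) / √b)
      - 2 / √b * Real.arctan (√(Real.log ((n - 1 : ℕ) : ℝ)) / √b) := by
  have hn1 : (((n - 1 : ℕ) : ℝ)) = (n : ℝ) - 1 := by
    rw [Nat.cast_sub (by omega)]; simp
  have hn2 : (2 : ℝ) ≤ n := by exact_mod_cast hn
  rw [hn1]
  have hsb : 0 < √b := Real.sqrt_pos.2 hb
  obtain ⟨c, hc, hcs⟩ := exists_hasDerivAt_eq_slope
    (fun t : ℝ => 2 / √b * Real.arctan (√(Real.log t) / √b))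
    (fun t : ℝ => 1 / (t * √(Real.log t) * (b + Real.log t)))
    (show (n : ℝ) - 1 < n by linarith)
    (by
      refine ContinuousOn.mul continuousOn_const ?_
      refine Real.continuous_arctan.comp_continuousOn ?_
      refine ContinuousOn.div_const ?_ _
      refine Real.continuous_sqrt.comp_continuousOn ?_
      refine Real.continuousOn_log.mono ?_
      intro t ht
      have : (0 : ℝ) < t := by linarith [ht.1]
      simpa using this.ne')
    (by
      intro t ht
      have ht1 : 1 < t := by linarith [ht.1]
      have hl : 0 < Real.log t := Real.log_pos ht1
      have hsl := Real.sqrt_pos.2 hl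
      have h := ((((Real.hasDerivAt_log (by linarith : t ≠ 0)).sqrt hl.ne').div_const
        (√b)).arctan).const_mul (2 / √b)
      refine h.congr_deriv ?_
      have e1 : √b ^ 2 = b := Real.sq_sqrt hb.le
      have e2 : √(Real.log t) ^ 2 = Real.log t := Real.sq_sqrt hl.le
      rw [div_pow, e1, e2]
      have hbl : b + Real.log t ≠ 0 := by positivity
      have hbl' : 1 + Real.log t / b ≠ 0 := by positivity
      field_simp
      try rw [e1])
  have hc1 : 1 < c := by linarith [hc.1]
  have hlc : 0 < Real.log c := Real.log_pos hc1
  have hsl := Real.sqrt_pos.2 hlc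
  have : (n : ℝ) - (n - 1) = 1 := by ring
  rw [this, div_one] at hcs
  rw [← hcs]
  have hcn : c ≤ n := hc.2.le
  have hlog : Real.log c ≤ Real.log n := Real.log_le_log (by linarith) hcn
  have hsq : √(Real.log c) ≤ √(Real.log n) := Real.sqrt_le_sqrt hlog
  refine one_div_le_one_div_of_le (by positivity) ?_
  gcongr

lemma sum_range_bound (b : ℝ) (hb : 0 < b) (N : ℕ) :
    ∑ n ∈ Finset.Ico 2 (N + 2), 1 / ((n : ℝ) * √(Real.log n) * (b + Real.log n)) ≤
      2 / √b * Real.arctan (√(Real.log ((N + 1 : ℕ) : ℝ)) / √b) := by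
  induction N with
  | zero => simp
  | succ N ih =>
    rw [Finset.sum_Ico_succ_top (by omega)]
    have := term_le b hb (N + 2) (by omega)
    simp only [show N + 2 - 1 = N + 1 by omega] at this
    have e : N + 1 + 1 = N + 2 := rfl
    rw [e]
    linarith

lemma sum_bound (b : ℝ) (hb : 0 < b) (s : Finset N2) :
    ∑ n ∈ s, 1 / (((n : ℕ) : ℝ) * √(Real.log (n : ℕ)) * (b + Real.log (n : ℕ))) ≤
      Real.pi / √b := by
  let f : ℕ → ℝ := fun n => 1 / ((n : ℝ) * √(Real.log n) * (b + Real.log n))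
  have hsb : 0 < √b := Real.sqrt_pos.2 hb
  have e : ∑ n ∈ s, f (n : ℕ) = ∑ n ∈ s.map (Function.Embedding.subtype _), f n := by
    rw [Finset.sum_map]; rfl
  change ∑ n ∈ s, f (n : ℕ) ≤ _
  rw [e]
  set t := s.map (Function.Embedding.subtype _) with ht
  have hsub : t ⊆ Finset.Ico 2 (t.sup id + 2) := by
    intro n hn
    rw [Finset.mem_Ico]
    have h2 : n ≤ t.sup id := Finset.le_sup (f := id) hn
    rw [ht, Finset.mem_map] at hn
    obtain ⟨k, _, rfl⟩ := hn
    exact ⟨k.2, by omega⟩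
  refine (Finset.sum_le_sum_of_subset_of_nonneg hsub fun n hn _ => ?_).trans
    ((sum_range_bound b hb _).trans ?_)
  · have := Real.log_natCast_nonneg n
    positivity
  · have := (Real.arctan_lt_pi_div_two (√(Real.log ((t.sup id + 1 : ℕ) : ℝ)) / √b)).le
    calc _ ≤ 2 / √b * (Real.pi / 2) := by gcongr
      _ = _ := by ring

/-- The Schur weight. -/
noncomputable def wt (n : N2) : ℝ := 1 / (√((n : ℕ) : ℝ) * √(Real.log (n : ℕ)))

/-- The multiplicative Hilbert matrix. -/
noncomputable def hil (m n : N2) : ℝ :=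
  1 / (√(((m : ℕ) : ℝ) * (n : ℕ)) * Real.log (((m : ℕ) : ℝ) * (n : ℕ)))

lemma N2_one_lt (n : N2) : (1 : ℝ) < (n : ℕ) := by
  have := n.2
  exact_mod_cast (by omega : 1 < (n : ℕ))

lemma wt_pos (n : N2) : 0 < wt n := by
  have h := N2_one_lt n
  have := Real.log_pos h
  have : (0 : ℝ) < (n : ℕ) := by linarith
  unfold wt
  positivity

lemma hil_symm (m n : N2) : hil m n = hil n m := by
  unfold hil; rw [mul_comm (((m : ℕ) : ℝ))]

lemma hil_schur (m : N2) (s : Finset N2) : ∑ n ∈ s, hil m n * wt n ≤ Real.pi * wt m := by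
  have hm := N2_one_lt m
  have hlm := Real.log_pos hm
  have hm0 : (0 : ℝ) < (m : ℕ) := by linarith
  have h := mul_le_mul_of_nonneg_left (sum_bound _ hlm s)
    (show 0 ≤ 1 / √((m : ℕ) : ℝ) by positivity)
  refine le_trans (le_of_eq ?_) (h.trans (le_of_eq ?_))
  · rw [Finset.mul_sum]
    refine Finset.sum_congr rfl fun n _ => ?_
    have hn := N2_one_lt n
    have hln := Real.log_pos hn
    have hn0 : (0 : ℝ) < (n : ℕ) := by linarith
    unfold hil wt
    rw [Real.sqrt_mul hm0.le, Real.log_mul hm0.ne' hn0.ne']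
    have e : (((n : ℕ) : ℝ)) = √((n : ℕ) : ℝ) * √((n : ℕ) : ℝ) := (Real.mul_self_sqrt hn0.le).symm
    rw [div_mul_div_comm, div_mul_div_comm]
    congr 1
    linear_combination (-(√((m : ℕ) : ℝ) * √(Real.log (n : ℕ)) *
        (Real.log (m : ℕ) + Real.log (n : ℕ)))) * e
  · unfold wt
    rw [div_mul_div_comm, mul_one_div, one_mul]

lemma hil_op (a : N2 → N2 → ℂ) (δ : ℝ) (hδ : 0 ≤ δ) (ha : ∀ m n, ‖a m n‖ ≤ δ * hil m n) :
    ∃ T : H2 →L[ℂ] H2, ‖T‖ ≤ δ * Real.pi ∧ ∀ x n, T x n = ∑' m, a m n * x m := by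
  refine schur a wt wt_pos _ (by positivity) ?_ ?_
  · intro m s
    calc _ ≤ ∑ n ∈ s, δ * (hil m n * wt n) := by
          refine Finset.sum_le_sum fun n _ => ?_
          rw [← mul_assoc]
          exact mul_le_mul_of_nonneg_right (ha m n) (wt_pos n).le
      _ ≤ _ := by
          rw [← Finset.mul_sum, mul_assoc]
          exact mul_le_mul_of_nonneg_left (hil_schur m s) hδ
  · intro m s
    calc _ ≤ ∑ n ∈ s, δ * (hil m n * wt n) := by
          refine Finset.sum_le_sum fun n _ => ?_
          rw [← mul_assoc, hil_symm]
          exact mul_le_mul_of_nonneg_right (ha n m) (wt_pos n).le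
      _ ≤ _ := by
          rw [← Finset.mul_sum, mul_assoc]
          exact mul_le_mul_of_nonneg_left (hil_schur m s) hδ

lemma entry_le (μ : Measure ℝ) (δ : ℝ) (m n : N2)
    (h : |Real.log ((m * n : ℕ) : ℝ) * lap μ (Real.log ((m * n : ℕ) : ℝ))| ≤ δ) :
    ‖helsonEntry μ m n‖ ≤ δ * hil m n := by
  have hm := N2_one_lt m
  have hn := N2_one_lt n
  have hmn : (1 : ℝ) < ((m : ℕ) : ℝ) * (n : ℕ) := one_lt_mul_of_lt_of_le hm hn.le
  have hl := Real.log_pos hmn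
  have h0 : (0 : ℝ) < ((m : ℕ) : ℝ) * (n : ℕ) := by linarith
  have hs := Real.sqrt_pos.2 h0
  push_cast at h
  rw [abs_mul, abs_of_pos hl] at h
  unfold helsonEntry hil
  rw [Complex.norm_real, Real.norm_eq_abs, abs_div, abs_of_pos hs, mul_one_div,
    div_le_div_iff₀ hs (by positivity)]
  nlinarith

lemma compact_of_finite (S : H2 →L[ℂ] H2) (t : Finset N2) (h : ∀ x, ∀ n ∉ t, S x n = 0) :
    IsCompactOperator S := by
  have e : S = ∑ n ∈ t, (lp.singleContinuousLinearMap ℂ (fun _ : N2 => ℂ) 2 n).comp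
      ((lp.evalCLM ℂ (fun _ : N2 => ℂ) 2 n).comp S) := by
    ext x k
    rw [ContinuousLinearMap.sum_apply, lp.coeFn_sum, Finset.sum_apply]
    change S x k = ∑ n ∈ t, (Pi.single n (S x n) : N2 → ℂ) k
    rw [Finset.sum_pi_single]
    split_ifs with hk
    · rfl
    · exact h x k hk
  rw [e]
  change _ ∈ compactOperator (RingHom.id ℂ) H2 H2
  refine Submodule.sum_mem _ fun n _ => ?_
  have : IsCompactOperator ((lp.evalCLM ℂ (fun _ : N2 => ℂ) 2 n).comp S) :=
    isCompactOperator_of_locallyCompactSpace_dom _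
  exact this.clm_comp (lp.singleContinuousLinearMap ℂ (fun _ : N2 => ℂ) 2 n)

theorem helson_compact (μ : Measure ℝ)
    (hμ : (∫⁻ t in Set.Ioi (0:ℝ), ENNReal.ofReal ((2:ℝ) ^ (-t)) ∂μ) < ⊤)
    (hlim : Filter.Tendsto (fun n : ℕ => Real.log n * lap μ (Real.log n))
      Filter.atTop (nhds 0)) :
    ∃ T : H2 →L[ℂ] H2,
      (∀ m n : N2, T (e2 m) n = helsonEntry μ m n) ∧ IsCompactOperator T := by
  obtain ⟨B, hB⟩ := hlim.abs.bddAbove_range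
  have hB' : ∀ k : ℕ, |Real.log k * lap μ (Real.log k)| ≤ B := fun k => hB ⟨k, rfl⟩
  have hB0 : 0 ≤ B := (abs_nonneg _).trans (hB' 0)
  obtain ⟨T, -, hT⟩ := hil_op (helsonEntry μ) B hB0
    fun m n => entry_le μ B m n (hB' _)
  refine ⟨T, ?_, ?_⟩
  · intro m n
    rw [hT, tsum_eq_single m]
    · simp [e2]
    · intro k hk
      have : e2 m k = 0 := lp.single_apply_ne 2 m 1 hk
      rw [this, mul_zero]
  · have hcl : T ∈ closure {S : H2 →L[ℂ] H2 | IsCompactOperator S} := by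
      rw [Metric.mem_closure_iff]
      intro ε hε
      set δ := ε / (2 * Real.pi) with hδd
      have hδ : 0 < δ := by positivity
      obtain ⟨N, hN⟩ := (Metric.tendsto_atTop.1 hlim) δ hδ
      obtain ⟨R, hRn, hR⟩ := hil_op
        (fun m n => if (n : ℕ) < N then 0 else helsonEntry μ m n) δ hδ.le (by
          intro m n
          split_ifs with hn
          · rw [norm_zero]
            have h1 := N2_one_lt m
            have h2 := N2_one_lt n
            have := Real.log_pos (one_lt_mul_of_lt_of_le h1 h2.le)
            unfold hil
            positivity
          · refine entry_le μ δ m n ?_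
            have hk : N ≤ (m : ℕ) * n := by
              have := m.2
              nlinarith
            have := hN _ hk
            rw [Real.dist_eq, sub_zero] at this
            exact this.le)
      refine ⟨T - R, ?_, ?_⟩
      · refine compact_of_finite _ ((Finset.range N).subtype _) fun x n hn => ?_
        have hn' : ¬ (n : ℕ) < N := by simpa using hn
        change T x n - R x n = 0
        rw [hT, hR]
        simp [hn']
      · rw [dist_eq_norm, sub_sub_cancel]
        refine hRn.trans_lt ?_
        rw [hδd]
        field_simp
        norm_num
    have := (isClosed_setOfPred_isCompactOperator (σ₁₂ := RingHom.id ℂ) (M₁ := H2) (M₂ := H2)).closure_eq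
    exact (Set.ext_iff.1 this T).1 hcl
end

section
/- For any $a \ge 0$, the matrix $H_a = \big(\frac{1}{\sqrt{mn}(a+\ln(mn))}\big)_{m,n\ge 2}$ defines a bounded operator on $\ell^2(\mathbb N_2)$ with $\|H_a\| = \pi$. -/
open MeasureTheory

open Real Set Filter Topology

theorem schur_aux (K : N2 → N2 → ℝ) (w : N2 → ℝ) (C : ℝ) (hC : 0 ≤ C)
    (hw : ∀ n, 0 < w n) (hK : ∀ m n, 0 ≤ K m n) (hs : ∀ m n, K m n = K n m)
    (h : ∀ n, ∀ F : Finset N2, ∑ m ∈ F, K m n * w m ≤ C * w n) :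
    ∃ T : H2 →L[ℂ] H2, (∀ m n : N2, T (e2 m) n = ((K m n : ℝ) : ℂ)) ∧ ‖T‖ ≤ C := by
  have hx2 : ∀ (x : H2) (F : Finset N2), ∑ m ∈ F, ‖x m‖ ^ 2 ≤ ‖x‖ ^ 2 := by
    intro x F
    have := lp.sum_rpow_le_norm_rpow (p := 2) (by norm_num) x F
    simpa using this
  have hcs : ∀ (x : H2) (n : N2) (F : Finset N2),
      (∑ m ∈ F, K m n * ‖x m‖) ^ 2 ≤ (C * w n) * ∑ m ∈ F, K m n * (‖x m‖ ^ 2 / w m) := by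
    intro x n F
    refine (Finset.sum_sq_le_sum_mul_sum_of_sq_le_mul F (f := fun m => K m n * w m)
      (g := fun m => K m n * (‖x m‖ ^ 2 / w m)) ?_ ?_ ?_).trans ?_
    · intro m _; exact mul_nonneg (hK _ _) (hw _).le
    · intro m _; exact mul_nonneg (hK _ _) (div_nonneg (sq_nonneg _) (hw _).le)
    · intro m _
      have := (hw m).ne'
      refine le_of_eq ?_
      field_simp
    · exact mul_le_mul_of_nonneg_right (h n F)
        (Finset.sum_nonneg fun m _ => mul_nonneg (hK _ _) (div_nonneg (sq_nonneg _) (hw _).le))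
  have hfin : ∀ (x : H2) (G F : Finset N2),
      ∑ n ∈ G, (∑ m ∈ F, K m n * ‖x m‖) ^ 2 ≤ C ^ 2 * ‖x‖ ^ 2 := by
    intro x G F
    calc _ ≤ ∑ n ∈ G, (C * w n) * ∑ m ∈ F, K m n * (‖x m‖ ^ 2 / w m) :=
          Finset.sum_le_sum fun n _ => hcs x n F
      _ = ∑ m ∈ F, (C * (‖x m‖ ^ 2 / w m)) * ∑ n ∈ G, K n m * w n := by
          simp only [Finset.mul_sum]
          rw [Finset.sum_comm]
          refine Finset.sum_congr rfl fun m _ => Finset.sum_congr rfl fun n _ => ?_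
          rw [hs m n]; ring
      _ ≤ ∑ m ∈ F, (C * (‖x m‖ ^ 2 / w m)) * (C * w m) :=
          Finset.sum_le_sum fun m _ => mul_le_mul_of_nonneg_left (h m G)
            (mul_nonneg hC (div_nonneg (sq_nonneg _) (hw _).le))
      _ = C ^ 2 * ∑ m ∈ F, ‖x m‖ ^ 2 := by
          rw [Finset.mul_sum]
          refine Finset.sum_congr rfl fun m _ => ?_
          have := (hw m).ne'
          field_simp
      _ ≤ _ := mul_le_mul_of_nonneg_left (hx2 x F) (sq_nonneg _)
  have hsum : ∀ (x : H2) (n : N2), Summable fun m => (K m n : ℂ) * x m := by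
    intro x n
    apply Summable.of_norm
    refine summable_of_sum_le (c := C * ‖x‖) (fun m => norm_nonneg _) fun F => ?_
    have := hfin x {n} F
    rw [Finset.sum_singleton, ← mul_pow] at this
    have := abs_le_of_sq_le_sq this (by positivity)
    refine le_trans (le_of_eq ?_) ((le_abs_self _).trans this)
    refine Finset.sum_congr rfl fun m _ => ?_
    rw [norm_mul, Complex.norm_real, Real.norm_of_nonneg (hK _ _)]
  have hbound : ∀ (x : H2) (G : Finset N2),
      ∑ n ∈ G, ‖∑' m, (K m n : ℂ) * x m‖ ^ 2 ≤ C ^ 2 * ‖x‖ ^ 2 := by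
    intro x G
    have ht : Tendsto (fun F : Finset N2 => ∑ n ∈ G, ‖∑ m ∈ F, (K m n : ℂ) * x m‖ ^ 2) atTop
        (𝓝 (∑ n ∈ G, ‖∑' m, (K m n : ℂ) * x m‖ ^ 2)) :=
      tendsto_finsetSum _ fun n _ => ((hsum x n).hasSum.norm.pow 2)
    refine le_of_tendsto' ht fun F => le_trans ?_ (hfin x G F)
    refine Finset.sum_le_sum fun n _ => ?_
    gcongr
    refine (norm_sum_le _ _).trans (le_of_eq ?_)
    refine Finset.sum_congr rfl fun m _ => ?_
    rw [norm_mul, Complex.norm_real, Real.norm_of_nonneg (hK _ _)]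
  have hmem : ∀ x : H2, Memℓp (fun n : N2 => ∑' m, (K m n : ℂ) * x m) 2 := by
    intro x
    refine memℓp_gen' (C := C ^ 2 * ‖x‖ ^ 2) fun G => ?_
    simpa using hbound x G
  let L : H2 →ₗ[ℂ] H2 :=
    { toFun := fun x => ⟨fun n : N2 => ∑' m, (K m n : ℂ) * x m, hmem x⟩
      map_add' := by
        intro x y
        ext n
        simp only [lp.coeFn_add, Pi.add_apply, mul_add]
        exact (hsum x n).tsum_add (hsum y n)
      map_smul' := by
        intro c x
        ext n
        simp only [lp.coeFn_smul, Pi.smul_apply, smul_eq_mul, RingHom.id_apply]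
        rw [← tsum_mul_left]
        refine tsum_congr fun m => by ring }
  have hL : ∀ x n, L x n = ∑' m, (K m n : ℂ) * x m := fun x n => rfl
  have hLb : ∀ x, ‖L x‖ ≤ C * ‖x‖ := by
    intro x
    refine lp.norm_le_of_forall_sum_le (p := 2) (by norm_num) (by positivity) fun G => ?_
    have := hbound x G
    rw [← mul_pow] at this
    simpa [hL] using this
  refine ⟨L.mkContinuous C hLb, ?_, L.mkContinuous_norm_le hC hLb⟩
  intro m n
  rw [LinearMap.mkContinuous_apply, hL, tsum_eq_single m]
  · simp [e2]
  · intro b hb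
    simp [e2, lp.single_apply, hb]

theorem lower_aux (K : N2 → N2 → ℝ) (w : N2 → ℝ) (T : H2 →L[ℂ] H2)
    (hT : ∀ m n : N2, T (e2 m) n = ((K m n : ℝ) : ℂ)) (s t : Finset N2) :
    ∑ n ∈ t, ∑ m ∈ s, w n * (K m n * w m) ≤
      ‖T‖ * √(∑ m ∈ s, w m ^ 2) * √(∑ n ∈ t, w n ^ 2) := by
  let v : Finset N2 → H2 := fun u => ∑ m ∈ u, (w m : ℂ) • e2 m
  have hin : ∀ (n : N2) (z : H2), inner ℂ (e2 n) z = z n := by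
    intro n z
    rw [e2, lp.inner_single_left]; simp
  have hv : ∀ u, ‖v u‖ = √(∑ m ∈ u, w m ^ 2) := by
    intro u
    have h0 := lp.norm_sum_single (p := 2) (E := fun _ : N2 => ℂ) (by norm_num)
      (fun m => (w m : ℂ)) u
    have h1 : v u = ∑ m ∈ u, lp.single 2 m (w m : ℂ) := by
      refine Finset.sum_congr rfl fun m _ => ?_
      rw [e2, ← lp.single_smul, smul_eq_mul, mul_one]
    rw [← h1] at h0
    have h2 : ‖v u‖ ^ 2 = ∑ m ∈ u, w m ^ 2 := by simpa using h0
    rw [← h2, Real.sqrt_sq (norm_nonneg _)]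
  have hTv : inner ℂ (v t) (T (v s)) = ((∑ n ∈ t, ∑ m ∈ s, w n * (K m n * w m) : ℝ) : ℂ) := by
    simp only [v, sum_inner, map_sum, map_smul, inner_smul_left, inner_sum, inner_smul_right, hin,
      hT]
    push_cast
    simp only [Complex.conj_ofReal]
    simp only [Finset.mul_sum]
    rw [Finset.sum_comm]
    refine Finset.sum_congr rfl fun n _ => ?_
    refine Finset.sum_congr rfl fun m _ => ?_
    ring
  have h1 := norm_inner_le_norm (𝕜 := ℂ) (v t) (T (v s))
  rw [hTv, Complex.norm_real] at h1
  have h2 := T.le_opNorm (v s)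
  rw [← hv, ← hv]
  refine (Real.le_norm_self _).trans (h1.trans ?_)
  rw [mul_comm]
  gcongr

theorem mvt_aux (F f : ℝ → ℝ) (p : ℝ) (hc : ContinuousOn F (Icc p (p+1)))
    (hd : ∀ x ∈ Ioo p (p+1), HasDerivAt F (f x) x) :
    ∃ x ∈ Ioo p (p+1), f x = F (p+1) - F p := by
  obtain ⟨x, hx, h⟩ := exists_hasDerivAt_eq_slope F f (by linarith : p < p + 1) hc hd
  exact ⟨x, hx, by simpa using h⟩

noncomputable def ff (c x : ℝ) : ℝ := 1 / (x * (c + log x) * √(log x))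
noncomputable def FF (c x : ℝ) : ℝ := 2 / √c * arctan (√(log x) / √c)

theorem FF_deriv {c x : ℝ} (hc : 0 < c) (hx : 1 < x) : HasDerivAt (FF c) (ff c x) x := by
  have hl : 0 < log x := Real.log_pos hx
  have h1 := (((Real.hasDerivAt_log (by linarith : x ≠ 0)).sqrt hl.ne').div_const (√c)).arctan.const_mul (2 / √c)
  refine h1.congr_deriv ?_
  unfold ff
  rw [div_pow, Real.sq_sqrt hl.le, Real.sq_sqrt hc.le]
  have := Real.sqrt_pos.2 hl
  have := Real.sqrt_pos.2 hc
  have h3 : √c ^ 2 = c := Real.sq_sqrt hc.le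
  have h4 : c + log x ≠ 0 := by positivity
  have h5 : x ≠ 0 := by linarith
  field_simp
  rw [h3]

theorem FF_cont {c p : ℝ} (hp : 1 ≤ p) : ContinuousOn (FF c) (Icc p (p+1)) := by
  unfold FF
  have : ContinuousOn (fun x => log x) (Icc p (p+1)) :=
    Real.continuousOn_log.mono (by intro x hx; have := hx.1; simp; linarith)
  fun_prop

theorem ff_anti {c x y : ℝ} (hc : 0 < c) (hx : 1 < x) (hxy : x ≤ y) : ff c y ≤ ff c x := by
  have hl : 0 < log x := Real.log_pos hx
  have hll : log x ≤ log y := Real.log_le_log (by linarith) hxy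
  have := Real.sqrt_pos.2 hl
  have hx0 : 0 < x := by linarith
  have hy0 : 0 < y := by linarith
  have hly : 0 < log y := by linarith
  unfold ff
  gcongr

theorem ff_upper {c : ℝ} (hc : 0 < c) (n : ℕ) (hn : 1 ≤ n) :
    ff c ((n + 1 : ℕ) : ℝ) ≤ FF c ((n + 1 : ℕ) : ℝ) - FF c n := by
  have hn' : (1 : ℝ) ≤ n := by exact_mod_cast hn
  obtain ⟨x, hx, h⟩ := mvt_aux (FF c) (ff c) n (FF_cont hn')
    (fun x hx => FF_deriv hc (by linarith [hx.1]))
  push_cast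
  rw [← h]
  exact ff_anti hc (by linarith [hx.1]) hx.2.le

theorem ff_lower {c : ℝ} (hc : 0 < c) (n : ℕ) (hn : 2 ≤ n) :
    FF c ((n + 1 : ℕ) : ℝ) - FF c n ≤ ff c n := by
  have hn' : (2 : ℝ) ≤ n := by exact_mod_cast hn
  obtain ⟨x, hx, h⟩ := mvt_aux (FF c) (ff c) n (FF_cont (by linarith))
    (fun x hx => FF_deriv hc (by linarith [hx.1]))
  push_cast
  rw [← h]
  exact ff_anti hc (by linarith) hx.1.le

theorem ff_sum_upper {c : ℝ} (hc : 0 < c) (N : ℕ) :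
    ∑ m ∈ Finset.Ico 2 (N + 2), ff c m ≤ π / √c := by
  have h : ∑ m ∈ Finset.Ico 2 (N + 2), ff c m ≤ FF c ((N + 1 : ℕ) : ℝ) := by
    induction N with
    | zero => 
      simp [FF]
    | succ k ih =>
      rw [show k + 1 + 2 = (k + 2) + 1 by ring, Finset.sum_Ico_succ_top (by omega)]
      have := ff_upper hc (k + 1) (by omega)
      rw [show k + 1 + 1 = k + 2 by ring] at *
      linarith
  refine h.trans ?_
  unfold FF
  have := (Real.arctan_lt_pi_div_two (√(log ((N + 1 : ℕ) : ℝ)) / √c)).le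
  calc _ ≤ 2 / √c * (π / 2) := by gcongr
    _ = _ := by ring

theorem ff_sum_lower {c : ℝ} (hc : 0 < c) (N : ℕ) (hN : 2 ≤ N) :
    FF c N - FF c 2 ≤ ∑ m ∈ Finset.Ico 2 (N + 1), ff c m := by
  have hpos : 0 ≤ ff c N := by
    have : 0 ≤ log (N : ℝ) := Real.log_natCast_nonneg _
    unfold ff; positivity
  suffices FF c N - FF c 2 ≤ ∑ m ∈ Finset.Ico 2 N, ff c m by
    rw [Finset.sum_Ico_succ_top hN]; linarith
  clear hpos
  induction N, hN using Nat.le_induction with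
  | base => simp
  | succ k hk ih =>
    rw [Finset.sum_Ico_succ_top hk]
    have := ff_lower hc k hk
    linarith

noncomputable def gg (x : ℝ) : ℝ := 1 / (x * log x)

theorem gg_nonneg (n : ℕ) : 0 ≤ gg n := by
  have : 0 ≤ log (n : ℝ) := Real.log_natCast_nonneg _
  unfold gg; positivity

theorem gg_anti {x y : ℝ} (hx : 1 < x) (hxy : x ≤ y) : gg y ≤ gg x := by
  have hl : 0 < log x := Real.log_pos hx
  have hll : log x ≤ log y := Real.log_le_log (by linarith) hxy
  have hx0 : 0 < x := by linarith
  have hy0 : 0 < y := by linarith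
  unfold gg
  gcongr

theorem gg_mvt (n : ℕ) (hn : 2 ≤ n) :
    gg ((n + 1 : ℕ) : ℝ) ≤ log (log ((n + 1 : ℕ) : ℝ)) - log (log n) ∧
    log (log ((n + 1 : ℕ) : ℝ)) - log (log n) ≤ gg n := by
  have hn' : (2 : ℝ) ≤ n := by exact_mod_cast hn
  have hd : ∀ x : ℝ, 1 < x → HasDerivAt (fun x => log (log x)) (gg x) x := by
    intro x hx
    have := (Real.hasDerivAt_log (by linarith : x ≠ 0)).log (Real.log_pos hx).ne'
    refine this.congr_deriv ?_
    unfold gg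
    rw [div_eq_mul_inv, one_div, mul_inv]
  obtain ⟨x, hx, h⟩ := mvt_aux (fun x => log (log x)) gg n
    (fun x hx => (hd x (by linarith [hx.1])).continuousAt.continuousWithinAt)
    (fun x hx => hd x (by linarith [hx.1]))
  push_cast
  rw [← h]
  exact ⟨gg_anti (by linarith [hx.1]) hx.2.le, gg_anti (by linarith) hx.1.le⟩

theorem gg_sum_upper (B N : ℕ) (hB : 2 ≤ B) (hN : B ≤ N) :
    ∑ m ∈ Finset.Ico (B + 1) (N + 1), gg m ≤ log (log N) - log (log B) := by
  induction N, hN using Nat.le_induction with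
  | base => simp
  | succ k hk ih =>
    rw [Finset.sum_Ico_succ_top (by omega)]
    have := (gg_mvt k (by omega)).1
    linarith

theorem gg_sum_lower (A N : ℕ) (hA : 2 ≤ A) (hN : A ≤ N) :
    log (log N) - log (log A) ≤ ∑ m ∈ Finset.Ico A (N + 1), gg m := by
  suffices log (log N) - log (log A) ≤ ∑ m ∈ Finset.Ico A N, gg m by
    rw [Finset.sum_Ico_succ_top hN]; linarith [gg_nonneg N]
  induction N, hN using Nat.le_induction with
  | base => simp
  | succ k hk ih =>
    rw [Finset.sum_Ico_succ_top hk]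
    have := (gg_mvt k (by omega)).2
    linarith

noncomputable def KK (a : ℝ) (m n : N2) : ℝ :=
  1 / (Real.sqrt ((m:ℝ) * (n:ℝ)) * (a + Real.log ((m:ℝ) * (n:ℝ))))
noncomputable def ww (n : N2) : ℝ := 1 / (√(n : ℝ) * √(log n))

theorem N2_two (n : N2) : (2 : ℝ) ≤ n := by exact_mod_cast n.2
theorem N2_log (n : N2) : 0 < log (n : ℝ) := Real.log_pos (by linarith [N2_two n])

theorem KK_ww (a : ℝ) (ha : 0 ≤ a) (m n : N2) :
    KK a m n * ww m = 1 / √(n : ℝ) * ff (a + log n) m := by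
  have hm := N2_two m
  have hn := N2_two n
  have := N2_log m
  have := N2_log n
  unfold KK ww ff
  rw [Real.log_mul (by linarith) (by linarith), Real.sqrt_mul (by linarith)]
  have h1 : (0 : ℝ) < √(m : ℝ) := Real.sqrt_pos.2 (by linarith)
  have h2 : (0 : ℝ) < √(n : ℝ) := Real.sqrt_pos.2 (by linarith)
  have h3 := Real.sqrt_pos.2 (N2_log m)
  have h4 : √(m : ℝ) * √(m : ℝ) = m := Real.mul_self_sqrt (by linarith)
  rw [show a + log (n : ℝ) + log (m : ℝ) = a + (log (m : ℝ) + log (n : ℝ)) by ring, 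
    div_mul_div_comm, div_mul_div_comm]
  congr 1
  calc _ = (√(m : ℝ) * √(m : ℝ)) * √(n : ℝ) * (a + (log (m : ℝ) + log n)) * √(log m) := by ring
    _ = _ := by rw [h4]; ring

theorem ww_sq (n : N2) : ww n ^ 2 = gg n := by
  unfold ww gg
  rw [div_pow, mul_pow, Real.sq_sqrt (by linarith [N2_two n]), Real.sq_sqrt (N2_log n).le, one_pow]

theorem ww_pos (n : N2) : 0 < ww n := by
  have h3 := Real.sqrt_pos.2 (N2_log n)
  have := N2_two n
  have h1 : (0 : ℝ) < √(n : ℝ) := Real.sqrt_pos.2 (by linarith)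
  unfold ww
  positivity

theorem row_upper (a : ℝ) (ha : 0 ≤ a) (n : N2) (F : Finset N2) :
    ∑ m ∈ F, KK a m n * ww m ≤ π * ww n := by
  have hl := N2_log n
  have hc : 0 < a + log (n : ℝ) := by linarith
  simp only [KK_ww a ha]
  rw [← Finset.mul_sum]
  have h1 : ∑ m ∈ F, ff (a + log n) m ≤ π / √(a + log n) := by
    have e : ∑ m ∈ F, ff (a + log n) m =
        ∑ m ∈ F.map (Function.Embedding.subtype _), ff (a + log n) (m : ℕ) := by
      rw [Finset.sum_map]; rfl
    obtain ⟨N, hN⟩ : ∃ N : ℕ, F.map (Function.Embedding.subtype _) ⊆ Finset.Ico 2 (N + 2) := by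
      refine ⟨(F.map (Function.Embedding.subtype _)).sup id, fun x hx => ?_⟩
      have := Finset.le_sup (f := id) hx
      simp only [Finset.mem_map] at hx
      obtain ⟨y, _, rfl⟩ := hx
      have := y.2
      simp at *
      omega
    rw [e]
    refine (Finset.sum_le_sum_of_subset_of_nonneg hN ?_).trans (ff_sum_upper hc N)
    intro i _ _
    have : 0 ≤ log (i : ℝ) := Real.log_natCast_nonneg _
    unfold ff; positivity
  calc _ ≤ 1 / √(n : ℝ) * (π / √(a + log n)) := by gcongr
    _ ≤ 1 / √(n : ℝ) * (π / √(log n)) := by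
      have := Real.sqrt_pos.2 hl
      have := Real.pi_pos
      gcongr
      linarith
    _ = _ := by unfold ww; ring

theorem sum_sub (f : ℕ → ℝ) (A B : ℕ) (hA : 2 ≤ A) :
    ∑ m ∈ (Finset.Ico A B).subtype (fun n => 2 ≤ n), f m = ∑ m ∈ Finset.Ico A B, f m := by
  apply Finset.sum_subtype_of_mem
  intro x hx
  have := Finset.mem_Ico.1 hx
  omega

theorem choose_aux (a κ : ℝ) (hκ : κ < π) : ∃ k A : ℕ, 1 ≤ k ∧ 2 ≤ A ∧
    ∀ n : ℕ, A ≤ n → a ≤ log n ∧ 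
      κ ≤ 2 * √(log n / (a + log n)) * (arctan (√(k / 2)) - arctan (√(log 2) / √(a + log n))) := by
  have h1 : Tendsto (fun k : ℕ => 2 * arctan (√((k : ℝ) / 2))) atTop (𝓝 (2 * (π / 2))) := by
    refine Tendsto.const_mul _ ?_
    refine (tendsto_nhds_of_tendsto_nhdsWithin Real.tendsto_arctan_atTop).comp ?_
    refine Real.tendsto_sqrt_atTop.comp ?_
    exact tendsto_natCast_atTop_atTop.atTop_div_const (by norm_num)
  have h2 := (h1.eventually_const_lt (u := κ) (by linarith)).and (eventually_ge_atTop 1)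
  obtain ⟨k, hk, hk1⟩ := h2.exists
  have hlog : Tendsto (fun n : ℕ => log (n : ℝ)) atTop atTop :=
    Real.tendsto_log_atTop.comp tendsto_natCast_atTop_atTop
  have hla : Tendsto (fun n : ℕ => a + log (n : ℝ)) atTop atTop :=
    tendsto_atTop_add_const_left _ _ hlog
  have h3 : Tendsto (fun n : ℕ => 2 * √(log (n : ℝ) / (a + log n)) *
      (arctan (√((k : ℝ) / 2)) - arctan (√(log 2) / √(a + log n)))) atTop
      (𝓝 (2 * √1 * (arctan (√((k : ℝ) / 2)) - arctan 0))) := by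
    refine Tendsto.mul (Tendsto.const_mul _ (Tendsto.sqrt ?_)) (Tendsto.const_sub _ ?_)
    · have : Tendsto (fun n : ℕ => 1 - a / (a + log (n : ℝ))) atTop (𝓝 (1 - 0)) :=
        Tendsto.const_sub _ (hla.const_div_atTop a)
      rw [sub_zero] at this
      refine this.congr' ?_
      filter_upwards [hla.eventually_gt_atTop 0] with n hn
      field_simp
      ring
    · refine (Real.continuous_arctan.tendsto 0).comp ?_
      exact (Real.tendsto_sqrt_atTop.comp hla).const_div_atTop _
  have h4 := h3.eventually_const_lt (u := κ) (by simpa using hk)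
  obtain ⟨A, hA⟩ := eventually_atTop.1 (h4.and (hlog.eventually_ge_atTop a))
  refine ⟨k, max A 2, hk1, le_max_right _ _, fun n hn => ?_⟩
  have := hA n (le_trans (le_max_left _ _) hn)
  exact ⟨this.2, this.1.le⟩

theorem row_lower (a κ : ℝ) (ha : 0 ≤ a) (k A B : ℕ) (hk : 1 ≤ k) (hA : 2 ≤ A)
    (h : ∀ n : ℕ, A ≤ n → a ≤ log n ∧ 
      κ ≤ 2 * √(log n / (a + log n)) * (arctan (√(k / 2)) - arctan (√(log 2) / √(a + log n))))
    (n : N2) (hAn : A ≤ n) (hnB : n ≤ B) :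
    κ * gg n ≤ ∑ m ∈ (Finset.Ico 2 (B ^ k + 1)).subtype (fun n => 2 ≤ n),
      ww n * (KK a m n * ww m) := by
  obtain ⟨h1, h2⟩ := h n hAn
  have hl := N2_log n
  have hc : 0 < a + log (n : ℝ) := by linarith
  have hB : 2 ≤ B := n.2.trans hnB
  have hsl := Real.sqrt_pos.2 hl
  have hsc := Real.sqrt_pos.2 hc
  have hn0 : (0:ℝ) < n := by linarith [N2_two n]
  have hBk : 2 ≤ B ^ k := hB.trans (Nat.le_self_pow (by omega) B)
  simp only [KK_ww a ha]
  rw [← Finset.mul_sum, ← Finset.mul_sum, sum_sub (fun m => ff (a + log n) m) 2 _ le_rfl]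
  have h3 := ff_sum_lower hc (B ^ k) hBk
  have h4 : √((k : ℝ) / 2) ≤ √(log ((B ^ k : ℕ) : ℝ)) / √(a + log n) := by
    rw [← Real.sqrt_div' _ hc.le]
    apply Real.sqrt_le_sqrt
    push_cast
    rw [Real.log_pow, div_le_div_iff₀ (by norm_num) hc, mul_assoc]
    have : log (n : ℝ) ≤ log B := Real.log_le_log hn0 (by exact_mod_cast hnB)
    gcongr
    linarith
  have h5 := Real.arctan_strictMono.monotone h4
  have h6 : κ * gg n ≤ ww n * (1 / √(n : ℝ) * (FF (a + log n) (B ^ k : ℕ) - FF (a + log n) 2)) := by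
    have e : ww n * (1 / √(n : ℝ) * (FF (a + log n) (B ^ k : ℕ) - FF (a + log n) 2)) =
        (2 * √(log n / (a + log n)) * (arctan (√(log ((B ^ k : ℕ) : ℝ)) / √(a + log n))
          - arctan (√(log 2) / √(a + log n)))) * gg n := by
      unfold ww FF gg
      rw [Real.sqrt_div hl.le]
      have q1 : (n : ℝ) = √(n : ℝ) ^ 2 := (Real.sq_sqrt hn0.le).symm
      have q2 : log (n : ℝ) = √(log (n : ℝ)) ^ 2 := (Real.sq_sqrt hl.le).symm
      have q3 := Real.sqrt_pos.2 hn0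
      generalize arctan (√(log ((B ^ k : ℕ) : ℝ)) / √(a + log n)) = X
      generalize arctan (√(log 2) / √(a + log n)) = Y
      generalize √(a + log n) = Z at *
      generalize √(log (n : ℝ)) = U at *
      generalize √(n : ℝ) = V at *
      rw [q2, q1]
      field_simp
    rw [e]
    refine mul_le_mul_of_nonneg_right (h2.trans ?_) (gg_nonneg n)
    gcongr
  refine h6.trans ?_
  have := ww_pos n
  gcongr

theorem norm_lower (a : ℝ) (ha : 0 ≤ a) (T : H2 →L[ℂ] H2)
    (hT : ∀ m n : N2, T (e2 m) n = ((KK a m n : ℝ) : ℂ)) : π ≤ ‖T‖ := by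
  refine le_of_forall_lt_imp_le_of_dense fun κ hκ => ?_
  by_contra! hlt
  have hκ0 : 0 < κ := lt_of_le_of_lt (norm_nonneg _) hlt
  obtain ⟨k, A, hk, hA, h⟩ := choose_aux a κ hκ
  set D := ∑ m ∈ Finset.Ico 2 A, gg m + log k with hD
  have key : ∀ B : ℕ, A ≤ B → (κ ^ 2 - ‖T‖ ^ 2) * ∑ m ∈ Finset.Ico A (B + 1), gg m ≤ ‖T‖ ^ 2 * D := by
    intro B hB
    have hBB : B ≤ B ^ k := Nat.le_self_pow (by omega) B
    have h1 := lower_aux (KK a) ww T hT ((Finset.Ico 2 (B ^ k + 1)).subtype (fun n => 2 ≤ n))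
      ((Finset.Ico A (B + 1)).subtype (fun n => 2 ≤ n))
    simp only [ww_sq] at h1
    rw [sum_sub (fun m => gg m) 2 _ le_rfl, sum_sub (fun m => gg m) A _ hA] at h1
    set Y := ∑ m ∈ Finset.Ico A (B + 1), gg m with hY
    set X := ∑ m ∈ Finset.Ico 2 (B ^ k + 1), gg m with hX
    have hY0 : 0 ≤ Y := Finset.sum_nonneg fun m _ => gg_nonneg m
    have hX0 : 0 ≤ X := Finset.sum_nonneg fun m _ => gg_nonneg m
    have h2 : κ * Y ≤ ‖T‖ * √X * √Y := by
      refine le_trans ?_ h1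
      rw [hY, ← sum_sub (fun m => gg m) A _ hA, Finset.mul_sum]
      refine Finset.sum_le_sum fun n hn => ?_
      have := Finset.mem_Ico.1 (Finset.mem_subtype.1 hn)
      exact row_lower a κ ha k A B hk hA h n this.1 (by omega)
    have h3 : X ≤ Y + D := by
      have e1 := Finset.sum_Ico_consecutive (fun m : ℕ => gg m) hA (by omega : A ≤ B + 1)
      have e2 := Finset.sum_Ico_consecutive (fun m : ℕ => gg m) (by omega : 2 ≤ B + 1) (by omega : B + 1 ≤ B ^ k + 1)
      have e3 := gg_sum_upper B (B ^ k) (by omega) hBB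
      have hlB : 0 < log (B : ℝ) := Real.log_pos (by exact_mod_cast (by omega : 1 < B))
      push_cast at e3
      rw [Real.log_pow, Real.log_mul (by positivity) hlB.ne'] at e3
      linarith
    have h4 : κ ^ 2 * Y ≤ ‖T‖ ^ 2 * X := by
      rcases hY0.eq_or_lt with h0 | h0
      · rw [← h0]; simp; positivity
      · have := pow_le_pow_left₀ (by positivity) h2 2
        rw [mul_pow, mul_pow, mul_pow, Real.sq_sqrt hX0, Real.sq_sqrt hY0] at this
        refine le_of_mul_le_mul_right ?_ h0
        linarith
    nlinarith [mul_le_mul_of_nonneg_left h3 (sq_nonneg ‖T‖)]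
  have hpos : 0 < κ ^ 2 - ‖T‖ ^ 2 := by
    have := pow_lt_pow_left₀ hlt (norm_nonneg _) (two_ne_zero)
    linarith
  have ht : Tendsto (fun B : ℕ => (κ ^ 2 - ‖T‖ ^ 2) * (log (log (B : ℝ)) - log (log A))) atTop atTop := by
    refine Tendsto.const_mul_atTop hpos ?_
    refine tendsto_atTop_add_const_right _ _ ?_
    exact Real.tendsto_log_atTop.comp (Real.tendsto_log_atTop.comp tendsto_natCast_atTop_atTop)
  obtain ⟨B, hB, hAB⟩ := ((ht.eventually_gt_atTop (‖T‖ ^ 2 * D)).and (eventually_ge_atTop A)).exists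
  have := key B hAB
  have := mul_le_mul_of_nonneg_left (gg_sum_lower A B hA hAB) hpos.le
  linarith

/-- For `a ≥ 0`, the matrix `(1/(√(mn)(a+ln(mn))))_{m,n ≥ 2}` defines a bounded operator on
`ℓ²(ℕ₂)` with norm exactly `π`. -/
theorem helson_exponential_norm (a : ℝ) (ha : 0 ≤ a) :
    ∃ T : H2 →L[ℂ] H2,
      (∀ m n : N2, T (e2 m) n =
        ((1 / (Real.sqrt ((m:ℝ) * (n:ℝ)) * (a + Real.log ((m:ℝ) * (n:ℝ)))) : ℝ) : ℂ)) ∧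
      ‖T‖ = Real.pi := by
  obtain ⟨T, hT, hle⟩ := schur_aux (KK a) ww π Real.pi_pos.le ww_pos
    (fun m n => by
      have h1 := N2_two m
      have h2 := N2_two n
      have : 0 ≤ Real.log ((m:ℝ) * (n:ℝ)) := Real.log_nonneg (by nlinarith)
      unfold KK; positivity)
    (fun m n => by unfold KK; rw [mul_comm (m : ℝ)])
    (row_upper a ha)
  exact ⟨T, hT, le_antisymm hle (norm_lower a ha T hT)⟩
end
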